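/- Let Ω be a probability space, G a finite group with the discrete measurable structure, and Q a finite measurable space. Let Z : Ω → G and S : Ω → Q be random variables, and let X : Ω → G be uniformly distributed on G and independent of the pair (Z, S). Define X̂ = Z * X (pointwise group product). Then, with entropies in nats, I[X̂ : (X, S)] = log|G| − H[Z | S]. -/

import Mathlib

open MeasureTheory ProbabilityTheory
open scoped ENNReal

/-- Shannon entropy (in nats) of a random variable with values in a finite set. -/
noncomputable def shannonEntropy {Ω α : Type*} [MeasurableSpace Ω] [Fintype α]
    (μ : Measure Ω) (X : Ω → α) : ℝ :=
  ∑ a : α, Real.negMulLog (μ (X ⁻¹' {a})).toReal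

/-- Conditional Shannon entropy `H[X | Y] = H[(X, Y)] - H[Y]` (in nats). -/
noncomputable def condShannonEntropy {Ω α β : Type*} [MeasurableSpace Ω] [Fintype α] [Fintype β]
    (μ : Measure Ω) (X : Ω → α) (Y : Ω → β) : ℝ :=
  shannonEntropy μ (fun ω => (X ω, Y ω)) - shannonEntropy μ Y

/-- Mutual information `I[X : Y] = H[X] + H[Y] - H[(X, Y)]` (in nats). -/
noncomputable def mutualInfoRV {Ω α β : Type*} [MeasurableSpace Ω] [Fintype α] [Fintype β]
    (μ : Measure Ω) (X : Ω → α) (Y : Ω → β) : ℝ :=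
  shannonEntropy μ X + shannonEntropy μ Y - shannonEntropy μ (fun ω => (X ω, Y ω))

theorem shannonEntropy_equiv_comp {Ω α β : Type*} [MeasurableSpace Ω] [Fintype α] [Fintype β]
    (μ : Measure Ω) (X : Ω → α) (e : α ≃ β) :
    shannonEntropy μ (fun ω => e (X ω)) = shannonEntropy μ X := by
  unfold shannonEntropy
  rw [← e.sum_comp]
  refine Finset.sum_congr rfl fun a _ => ?_
  congr 3
  ext ω
  simp

theorem sum_toReal_measure_preimage_singleton {Ω α : Type*} [MeasurableSpace Ω] [Fintype α]
    [MeasurableSpace α] [MeasurableSingletonClass α] (μ : Measure Ω) [IsProbabilityMeasure μ]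
    {X : Ω → α} (hX : Measurable X) :
    ∑ a : α, (μ (X ⁻¹' {a})).toReal = 1 := by
  rw [← ENNReal.toReal_sum fun a _ => measure_ne_top μ _,
    sum_measure_preimage_singleton _ fun a _ => hX (measurableSet_singleton a)]
  simp

theorem shannonEntropy_prodMk_of_indepFun {Ω α β : Type*} [MeasurableSpace Ω]
    [Fintype α] [MeasurableSpace α] [MeasurableSingletonClass α]
    [Fintype β] [MeasurableSpace β] [MeasurableSingletonClass β]
    (μ : Measure Ω) [IsProbabilityMeasure μ] {X : Ω → α} {Y : Ω → β}
    (hX : Measurable X) (hY : Measurable Y) (hXY : IndepFun X Y μ) :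
    shannonEntropy μ (fun ω => (X ω, Y ω)) = shannonEntropy μ X + shannonEntropy μ Y := by
  have hprod (a : α) (b : β) : (μ ((fun ω => (X ω, Y ω)) ⁻¹' {(a, b)})).toReal =
      (μ (X ⁻¹' {a})).toReal * (μ (Y ⁻¹' {b})).toReal := by
    rw [← Set.singleton_prod_singleton, Set.mk_preimage_prod,
      hXY.measure_inter_preimage_eq_mul _ _ (measurableSet_singleton a)
        (measurableSet_singleton b), ENNReal.toReal_mul]
  simp only [shannonEntropy, Fintype.sum_prod_type, hprod, Real.negMulLog_mul,
    Finset.sum_add_distrib, ← Finset.sum_mul, ← Finset.mul_sum,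
    sum_toReal_measure_preimage_singleton μ hX, sum_toReal_measure_preimage_singleton μ hY, one_mul]

theorem shannonEntropy_of_uniform {Ω α : Type*} [MeasurableSpace Ω] [Fintype α] [Nonempty α]
    (μ : Measure Ω) {X : Ω → α}
    (hunif : ∀ a : α, μ (X ⁻¹' {a}) = ((Fintype.card α : ℝ≥0∞))⁻¹) :
    shannonEntropy μ X = Real.log (Fintype.card α) := by
  simp [shannonEntropy, hunif, Real.negMulLog]

theorem measure_preimage_mul_singleton_of_uniform {Ω G : Type*} [MeasurableSpace Ω]
    [Group G] [Fintype G] [MeasurableSpace G] [MeasurableSingletonClass G]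
    (μ : Measure Ω) [IsProbabilityMeasure μ] {Z X : Ω → G} (hZ : Measurable Z)
    (hunif : ∀ g : G, μ (X ⁻¹' {g}) = ((Fintype.card G : ℝ≥0∞))⁻¹)
    (hindep : IndepFun Z X μ) (g : G) :
    μ ((fun ω => Z ω * X ω) ⁻¹' {g}) = ((Fintype.card G : ℝ≥0∞))⁻¹ := by
  have hpreim (z : G) : Z ⁻¹' {z} ∩ (fun ω => Z ω * X ω) ⁻¹' {g} =
      Z ⁻¹' {z} ∩ X ⁻¹' {z⁻¹ * g} := by
    ext ω
    simp only [Set.mem_inter_iff, Set.mem_preimage, Set.mem_singleton_iff, eq_inv_mul_iff_mul_eq]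
    exact and_congr_right fun h => by rw [h]
  have htotal := sum_measure_preimage_singleton (μ := μ.restrict ((fun ω => Z ω * X ω) ⁻¹' {g}))
    Finset.univ fun z _ => hZ (measurableSet_singleton z)
  have hone := sum_measure_preimage_singleton (μ := μ)
    Finset.univ fun z _ => hZ (measurableSet_singleton z)
  simp only [Finset.coe_univ, Set.preimage_univ, Measure.restrict_apply_univ, measure_univ]
    at htotal hone
  rw [← htotal, ← one_mul (_⁻¹), ← hone, Finset.sum_mul]
  refine Finset.sum_congr rfl fun z _ => ?_
  rw [Measure.restrict_apply (hZ (measurableSet_singleton z)), hpreim,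
    hindep.measure_inter_preimage_eq_mul _ _ (measurableSet_singleton z)
      (measurableSet_singleton _), hunif]

/-- **Equality step in the proof of Theorem 1.**
If `X` is uniform on the finite group `G` and independent of the pair `(Z, S)`,
then the test channel `X̂ = Z * X` achieves
`I[X̂ : (X, S)] = log |G| - H[Z | S]` (entropies in nats). -/
theorem mutualInfo_testChannel_eq_log_card_sub_condEntropy
    {Ω G Q : Type*} [MeasurableSpace Ω]
    [Group G] [Fintype G] [MeasurableSpace G] [DiscreteMeasurableSpace G]
    [Fintype Q] [MeasurableSpace Q] [DiscreteMeasurableSpace Q]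
    (μ : Measure Ω) [IsProbabilityMeasure μ]
    (Z : Ω → G) (S : Ω → Q) (X : Ω → G)
    (hZ : Measurable Z) (hS : Measurable S) (hX : Measurable X)
    (hunif : ∀ g : G, μ (X ⁻¹' {g}) = ((Fintype.card G : ℝ≥0∞))⁻¹)
    (hindep : IndepFun X (fun ω => (Z ω, S ω)) μ) :
    mutualInfoRV μ (fun ω => Z ω * X ω) (fun ω => (X ω, S ω)) =
      Real.log (Fintype.card G) - condShannonEntropy μ Z S := by
  have hXZ : IndepFun X Z μ := hindep.comp measurable_id measurable_fst
  have hXS : IndepFun X S μ := hindep.comp measurable_id measurable_snd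
  let e : G × G × Q ≃ G × G × Q :=
    { toFun := fun p => (p.2.1 * p.1, p.1, p.2.2)
      invFun := fun p => (p.2.1, p.1 * p.2.1⁻¹, p.2.2)
      left_inv := fun p => by simp
      right_inv := fun p => by simp }
  have hjoint : shannonEntropy μ (fun ω => (Z ω * X ω, X ω, S ω)) =
      shannonEntropy μ X + shannonEntropy μ (fun ω => (Z ω, S ω)) :=
    (shannonEntropy_equiv_comp μ (fun ω => (X ω, Z ω, S ω)) e).trans
      (shannonEntropy_prodMk_of_indepFun μ hX (hZ.prodMk hS) hindep)
  rw [mutualInfoRV, condShannonEntropy, hjoint, shannonEntropy_prodMk_of_indepFun μ hX hS hXS,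
    shannonEntropy_of_uniform μ
      (measure_preimage_mul_singleton_of_uniform μ hZ hunif hXZ.symm)]
  ring
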